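/- arXiv:2604.24632 — 5 statements merged into one kernel-verified Lean document; each statement's English description precedes it below -/
import Mathlib

section
/- Fix d ≥ 2 and s > 0. Let μ_{s,d} = (1/(2d)) Σ_{i=1}^d (δ_{s e_i} + δ_{−s e_i}), where e_1,…,e_d are the standard basis vectors of ℝ^d, and let ν = μ_{s,d} * γ. Then Cov(μ_{s,d}) = (s²/d) I_d, so ‖Cov(μ_{s,d})‖_F = s²/√d, and W₁(γ, ν) ≥ s/2 − √(2 log d). In particular, if s ≥ 4√(2 log d), then W₁(μ_{s,d} * γ, γ) ≥ s/4. -/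
open MeasureTheory ProbabilityTheory Real ENNReal RealInnerProductSpace

noncomputable section

/-- The set of couplings of two measures `μ` and `ν`. -/
def couplings {E : Type*} [MeasurableSpace E] (μ ν : Measure E) : Set (Measure (E × E)) :=
  {τ | τ.map Prod.fst = μ ∧ τ.map Prod.snd = ν}

/-- The Wasserstein-`p` distance, valued in `ℝ≥0∞`:
`W_p(μ,ν) = (inf over couplings τ of ∫ ‖z₁ - z₂‖^p dτ)^{1/p}`. -/
noncomputable def Wp {E : Type*} [MeasurableSpace E] [NormedAddCommGroup E]
    (p : ℝ) (μ ν : Measure E) : ℝ≥0∞ :=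
  (⨅ τ ∈ couplings μ ν, ∫⁻ z : E × E, ENNReal.ofReal (‖z.1 - z.2‖ ^ p) ∂τ) ^ (1 / p)

/-- The standard Gaussian measure `N(0, I_d)` on `ℝ^d`. -/
noncomputable def stdGaussian (d : ℕ) : Measure (EuclideanSpace ℝ (Fin d)) :=
  (Measure.pi fun _ : Fin d => gaussianReal 0 1).map
    ((EuclideanSpace.equiv (Fin d) ℝ).symm : (Fin d → ℝ) → EuclideanSpace ℝ (Fin d))

/-- The Gaussian measure `N(m, I_d)` on `ℝ^d`. -/
noncomputable def gaussianE (d : ℕ) (m : EuclideanSpace ℝ (Fin d)) :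
    Measure (EuclideanSpace ℝ (Fin d)) :=
  (stdGaussian d).map (fun x => m + x)

/-- `C_p = (E_{ξ ∼ N(0,1)} |ξ|^p)^{1/p}`. -/
noncomputable def Cconst (p : ℝ) : ℝ := (∫ ξ : ℝ, |ξ| ^ p ∂(gaussianReal 0 1)) ^ (1 / p)

/-- `K_p = max {1, C_p/2 + 1/3}`. -/
noncomputable def Kconst (p : ℝ) : ℝ := max 1 (Cconst p / 2 + 1 / 3)

/-- The constant `c₄ = (e⁴ - 5)/16`. -/
noncomputable def cFour : ℝ := (Real.exp 4 - 5) / 16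

/-- The (second-moment) covariance matrix `∫ x xᵀ dμ` of a (centred) measure on `ℝ^d`. -/
noncomputable def covMat {d : ℕ} (μ : Measure (EuclideanSpace ℝ (Fin d))) :
    Matrix (Fin d) (Fin d) ℝ :=
  Matrix.of fun i j => ∫ x, x i * x j ∂μ

/-- The Frobenius norm of a matrix. -/
noncomputable def frob {d : ℕ} (A : Matrix (Fin d) (Fin d) ℝ) : ℝ :=
  Real.sqrt (∑ i, ∑ j, (A i j) ^ 2)

/-- `τ₁ = E[‖X‖ 1_{‖X‖ > 1}]`. -/
noncomputable def tailOne {d : ℕ} (μ : Measure (EuclideanSpace ℝ (Fin d))) : ℝ :=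
  ∫ x in {x : EuclideanSpace ℝ (Fin d) | 1 < ‖x‖}, ‖x‖ ∂μ

/-- `τ₂ = (E[‖X‖² 1_{‖X‖ > 1}])^{1/2}`. -/
noncomputable def tailTwo {d : ℕ} (μ : Measure (EuclideanSpace ℝ (Fin d))) : ℝ :=
  Real.sqrt (∫ x in {x : EuclideanSpace ℝ (Fin d) | 1 < ‖x‖}, ‖x‖ ^ 2 ∂μ)

/-- `m = E[X 1_{‖X‖ ≤ 1}]`. -/
noncomputable def truncMean {d : ℕ} (μ : Measure (EuclideanSpace ℝ (Fin d))) :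
    EuclideanSpace ℝ (Fin d) :=
  ∫ x in {x : EuclideanSpace ℝ (Fin d) | ‖x‖ ≤ 1}, x ∂μ

/-- `X̃ = X 1_{‖X‖ ≤ 1} - E[X 1_{‖X‖ ≤ 1}]`, as a function of `X`. -/
noncomputable def truncCentred {d : ℕ} (μ : Measure (EuclideanSpace ℝ (Fin d)))
    (x : EuclideanSpace ℝ (Fin d)) : EuclideanSpace ℝ (Fin d) :=
  (if ‖x‖ ≤ 1 then x else 0) - truncMean μ

/-- `Σ̃ = Cov(X̃) = E[X̃ X̃ᵀ]` (note `X̃` is centred). -/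
noncomputable def truncCov {d : ℕ} (μ : Measure (EuclideanSpace ℝ (Fin d))) :
    Matrix (Fin d) (Fin d) ℝ :=
  Matrix.of fun i j => ∫ x, truncCentred μ x i * truncCentred μ x j ∂μ

/-- The chi-squared divergence `χ²(ρ ‖ γ) = ∫ ((dρ/dγ) - 1)² dγ`. -/
noncomputable def chiSqDiv {E : Type*} [MeasurableSpace E] (ρ γm : Measure E) : ℝ :=
  ∫ x, ((ρ.rnDeriv γm x).toReal - 1) ^ 2 ∂γm

/-- The Kullback–Leibler divergence `KL(ρ ‖ γ) = ∫ log (dρ/dγ) dρ`. -/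
noncomputable def klDivReal {E : Type*} [MeasurableSpace E] (ρ γm : Measure E) : ℝ :=
  ∫ x, Real.log ((ρ.rnDeriv γm x).toReal) ∂ρ

/-- The Jacobian matrix `∇φ(x)` of a map `φ : ℝ^d → ℝ^d`, with entry `(i,j)` equal to
`∂φ_i/∂x_j (x)`. -/
noncomputable def jacobianM {d : ℕ}
    (φ : EuclideanSpace ℝ (Fin d) → EuclideanSpace ℝ (Fin d))
    (x : EuclideanSpace ℝ (Fin d)) : Matrix (Fin d) (Fin d) ℝ :=
  Matrix.of fun i j => fderiv ℝ φ x (EuclideanSpace.single j (1 : ℝ)) i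

/-- `τ` is a Stein kernel for the centred measure `ρ` relative to the standard Gaussian:
for all `φ ∈ C_c^∞(ℝ^d; ℝ^d)`, `E⟨X, φ(X)⟩ = E[tr(τ(X) ∇φ(X))]`. -/
def IsSteinKernel {d : ℕ} (ρ : Measure (EuclideanSpace ℝ (Fin d)))
    (τ : EuclideanSpace ℝ (Fin d) → Matrix (Fin d) (Fin d) ℝ) : Prop :=
  ∀ φ : EuclideanSpace ℝ (Fin d) → EuclideanSpace ℝ (Fin d),
    ContDiff ℝ (⊤ : ℕ∞) φ → HasCompactSupport φ →
      ∫ x, ⟪x, φ x⟫ ∂ρ = ∫ x, Matrix.trace (τ x * jacobianM φ x) ∂ρ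

/-- Easy half of Kantorovich duality: a `1`-Lipschitz function bounds the Wasserstein-`1`
distance from below. -/
theorem ofReal_integral_sub_integral_le_Wp_one {E : Type*} [MeasurableSpace E]
    [NormedAddCommGroup E] {μ ν : Measure E} {f : E → ℝ} (hf : LipschitzWith 1 f)
    (hμ : Integrable f μ) (hν : Integrable f ν) :
    ENNReal.ofReal (∫ x, f x ∂ν - ∫ x, f x ∂μ) ≤ Wp 1 μ ν := by
  simp only [Wp, Real.rpow_one, div_one, ENNReal.rpow_one]
  refine le_iInf₂ fun τ hτ => ?_
  obtain ⟨rfl, rfl⟩ := hτ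
  rw [integral_map measurable_fst.aemeasurable hμ.1, integral_map measurable_snd.aemeasurable hν.1,
    ← integral_sub (f := fun z : E × E => f z.2) (g := fun z => f z.1)
      (hν.comp_measurable measurable_snd) (hμ.comp_measurable measurable_fst)]
  refine (ENNReal.ofReal_mono (le_abs_self _)).trans ?_
  rw [← Real.norm_eq_abs]
  refine (ofReal_norm _).trans_le ((enorm_integral_le_lintegral_enorm _).trans ?_)
  refine lintegral_mono fun z => ?_
  rw [← ofReal_norm]
  refine ENNReal.ofReal_mono ?_
  have h := hf.dist_le_mul z.2 z.1
  rwa [NNReal.coe_one, one_mul, dist_eq_norm, dist_comm, dist_eq_norm] at h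

theorem map_eval_stdGaussian (d : ℕ) (i : Fin d) :
    (_root_.stdGaussian d).map (fun x => x i) = gaussianReal 0 1 := by
  rw [_root_.stdGaussian, Measure.map_map (by fun_prop) (by fun_prop)]
  exact (measurePreserving_eval (fun _ : Fin d => gaussianReal 0 1) i).map_eq

instance isProbabilityMeasure_stdGaussian (d : ℕ) :
    IsProbabilityMeasure (_root_.stdGaussian d) :=
  Measure.isProbabilityMeasure_map (by fun_prop)

theorem integrable_id_stdGaussian (d : ℕ) :
    Integrable (fun x => x) (_root_.stdGaussian d) := by
  rw [← memLp_one_iff_integrable]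
  refine MemLp.of_eval_piLp fun i => ?_
  have h := memLp_id_gaussianReal (μ := 0) (v := 1) 1
  rw [← map_eval_stdGaussian d i] at h
  exact h.comp_of_map (by fun_prop)

theorem integral_eval_stdGaussian (d : ℕ) (i : Fin d) :
    ∫ x, x i ∂(_root_.stdGaussian d) = 0 := by
  have h := integral_id_gaussianReal (μ := 0) (v := 1)
  rwa [← map_eval_stdGaussian d i, integral_map (by fun_prop) (by fun_prop)] at h

theorem integrable_exp_eval_stdGaussian (d : ℕ) (i : Fin d) (t : ℝ) :
    Integrable (fun x => Real.exp (t * x i)) (_root_.stdGaussian d) := by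
  have h := integrable_exp_mul_gaussianReal (μ := 0) (v := 1) t
  rw [← map_eval_stdGaussian d i] at h
  exact h.comp_measurable (by fun_prop)

theorem integral_exp_eval_stdGaussian (d : ℕ) (i : Fin d) (t : ℝ) :
    ∫ x, Real.exp (t * x i) ∂(_root_.stdGaussian d) = Real.exp (t ^ 2 / 2) := by
  have h := mgf_gaussianReal (map_eval_stdGaussian d i) t
  simpa [mgf] using h

/-- A `1`-Lipschitz function is integrable with respect to any translate of the standard
Gaussian. -/
theorem LipschitzWith.integrable_comp_add_stdGaussian {d : ℕ}
    {f : EuclideanSpace ℝ (Fin d) → ℝ} (hf : LipschitzWith 1 f) (a : EuclideanSpace ℝ (Fin d)) :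
    Integrable (fun x => f (a + x)) (_root_.stdGaussian d) := by
  refine ((integrable_const ‖f a‖).add (integrable_id_stdGaussian d).norm).mono'
    (hf.continuous.comp (continuous_const.add continuous_id)).aestronglyMeasurable
    (ae_of_all _ fun x => ?_)
  have h := hf.dist_le_mul (a + x) a
  rw [dist_eq_norm, dist_eq_norm, add_sub_cancel_left, NNReal.coe_one, one_mul] at h
  have := norm_sub_norm_le (f (a + x)) (f a)
  simp only [Pi.add_apply]
  linarith

/-- The largest coordinate of a vector. -/
def coordMax {d : ℕ} (x : EuclideanSpace ℝ (Fin d)) : ℝ := ⨆ i, x i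

theorem le_coordMax {d : ℕ} (x : EuclideanSpace ℝ (Fin d)) (i : Fin d) : x i ≤ coordMax x :=
  le_ciSup (Set.finite_range fun i => x i).bddAbove i

theorem lipschitzWith_coordMax (d : ℕ) [NeZero d] :
    LipschitzWith 1 (coordMax : EuclideanSpace ℝ (Fin d) → ℝ) := by
  refine LipschitzWith.of_le_add fun x y => ciSup_le fun i => ?_
  have h : ‖(x - y) i‖ ≤ ‖x - y‖ := PiLp.norm_apply_le _ i
  rw [Real.norm_eq_abs, PiLp.sub_apply] at h
  have := le_coordMax y i
  have := le_abs_self (x i - y i)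
  rw [dist_eq_norm]
  linarith

theorem integral_coordMax_stdGaussian_le {d : ℕ} (hd : 2 ≤ d) :
    ∫ x, coordMax x ∂(_root_.stdGaussian d) ≤ √(2 * Real.log d) := by
  have : NeZero d := ⟨by omega⟩
  have hd' : (1 : ℝ) < d := by exact_mod_cast hd
  have hlog := Real.log_pos hd'
  set t := √(2 * Real.log d) with ht
  have ht0 : 0 < t := by positivity
  have ht2 : t ^ 2 = 2 * Real.log d := Real.sq_sqrt (by positivity)
  have hpt : ∀ x : EuclideanSpace ℝ (Fin d),
      t * coordMax x ≤ t ^ 2 - 1 + Real.exp (-t ^ 2) * ∑ i, Real.exp (t * x i) := by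
    intro x
    obtain ⟨j, hj⟩ := exists_eq_ciSup_of_finite (f := fun i => x i)
    have h1 := Real.add_one_le_exp (t * x j - t ^ 2)
    have h2 : Real.exp (t * x j) ≤ ∑ i, Real.exp (t * x i) :=
      Finset.single_le_sum (f := fun i => Real.exp (t * x i)) (fun i _ => (Real.exp_pos _).le)
        (Finset.mem_univ j)
    have h3 := mul_le_mul_of_nonneg_left h2 (Real.exp_pos (-t ^ 2)).le
    rw [← Real.exp_add, show -t ^ 2 + t * x j = t * x j - t ^ 2 by ring] at h3
    rw [coordMax, ← hj]
    linarith
  have hint := (lipschitzWith_coordMax d).integrable_comp_add_stdGaussian 0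
  simp only [zero_add] at hint
  have hsum : Integrable (fun x : EuclideanSpace ℝ (Fin d) => ∑ i, Real.exp (t * x i))
      (_root_.stdGaussian d) :=
    integrable_finsetSum _ fun i _ => integrable_exp_eval_stdGaussian d i t
  have hle := integral_mono (hint.const_mul t)
    ((integrable_const (t ^ 2 - 1)).add (hsum.const_mul (Real.exp (-t ^ 2)))) hpt
  simp only [Pi.add_apply] at hle
  rw [integral_const_mul, integral_add (integrable_const _) (hsum.const_mul _),
    integral_const_mul, integral_finsetSum _
      fun i _ => integrable_exp_eval_stdGaussian d i t] at hle
  simp only [integral_exp_eval_stdGaussian, Finset.sum_const, Finset.card_univ, Fintype.card_fin,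
    nsmul_eq_mul, integral_const, probReal_univ, one_smul] at hle
  have hexp : Real.exp (-t ^ 2) * (d * Real.exp (t ^ 2 / 2)) = 1 := by
    nth_rewrite 1 [← Real.exp_log (zero_lt_one.trans hd')]
    rw [← Real.exp_add, ← Real.exp_add, Real.exp_eq_one_iff]
    linarith
  rw [hexp] at hle
  nlinarith

theorem eval_le_integral_coordMax_add {d : ℕ} [NeZero d] (a : EuclideanSpace ℝ (Fin d))
    (i : Fin d) : a i ≤ ∫ x, coordMax (a + x) ∂(_root_.stdGaussian d) := by
  have hi : Integrable (fun x : EuclideanSpace ℝ (Fin d) => x i) (_root_.stdGaussian d) :=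
    (integrable_id_stdGaussian d).eval_piLp i
  have h := integral_mono ((integrable_const (a i)).add hi)
    ((lipschitzWith_coordMax d).integrable_comp_add_stdGaussian a) fun x => le_coordMax (a + x) i
  simp only [Pi.add_apply] at h
  rw [integral_add (integrable_const _) hi] at h
  simpa [integral_eval_stdGaussian] using h

/-- The uniform measure on the `2d` vectors `± s eᵢ`. -/
def spikeMeasure (d : ℕ) (s : ℝ) : Measure (EuclideanSpace ℝ (Fin d)) :=
  ((2 * d : ℝ≥0∞))⁻¹ •
    ∑ i : Fin d,
      (Measure.dirac (s • (EuclideanSpace.single i (1 : ℝ))) +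
        Measure.dirac (-(s • (EuclideanSpace.single i (1 : ℝ)))))

theorem integrable_spikeMeasure {d : ℕ} [NeZero d] (s : ℝ) (f : EuclideanSpace ℝ (Fin d) → ℝ) :
    Integrable f (spikeMeasure d s) := by
  refine Integrable.smul_measure ?_ (by simp [NeZero.ne d])
  exact integrable_finsetSum_measure.2 fun i _ =>
    (integrable_dirac enorm_lt_top).add_measure (integrable_dirac enorm_lt_top)

instance isFiniteMeasure_spikeMeasure {d : ℕ} [NeZero d] (s : ℝ) :
    IsFiniteMeasure (spikeMeasure d s) :=
  (integrable_const_iff_isFiniteMeasure (one_ne_zero (α := ℝ))).1 (integrable_spikeMeasure s _)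

theorem integral_spikeMeasure {d : ℕ} (s : ℝ) (f : EuclideanSpace ℝ (Fin d) → ℝ) :
    ∫ x, f x ∂(spikeMeasure d s) = (2 * d : ℝ)⁻¹ *
      ∑ i : Fin d, (f (s • EuclideanSpace.single i 1) + f (-(s • EuclideanSpace.single i 1))) := by
  rw [spikeMeasure, integral_smul_measure, integral_finsetSum_measure fun i _ =>
    (integrable_dirac enorm_lt_top).add_measure (integrable_dirac enorm_lt_top)]
  simp_rw [integral_add_measure (integrable_dirac (f := f) enorm_lt_top)
    (integrable_dirac enorm_lt_top), integral_dirac]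
  simp

theorem covMat_spikeMeasure (d : ℕ) (s : ℝ) :
    covMat (spikeMeasure d s) = (s ^ 2 / d) • (1 : Matrix (Fin d) (Fin d) ℝ) := by
  ext i j
  simp only [covMat, Matrix.of_apply, integral_spikeMeasure, Matrix.smul_apply, Matrix.one_apply,
    PiLp.smul_apply, PiLp.neg_apply, PiLp.single_apply, smul_eq_mul]
  have h (k : Fin d) : s * (if i = k then (1 : ℝ) else 0) * (s * if j = k then 1 else 0) +
      -(s * (if i = k then (1 : ℝ) else 0)) * -(s * if j = k then 1 else 0) =
      if i = k then (if i = j then 2 * s ^ 2 else 0) else 0 := by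
    split_ifs <;> grind
  simp_rw [h]
  simp only [Finset.sum_ite_eq, Finset.mem_univ, if_true]
  split_ifs
  · field_simp
  · simp

theorem frob_smul_one {d : ℕ} {c : ℝ} (hc : 0 ≤ c) :
    frob (c • (1 : Matrix (Fin d) (Fin d) ℝ)) = √d * c := by
  simp [frob, Matrix.one_apply, Real.sqrt_sq hc]

theorem LipschitzWith.integrable_spikeMeasure_conv {d : ℕ} [NeZero d] (s : ℝ)
    {f : EuclideanSpace ℝ (Fin d) → ℝ} (hf : LipschitzWith 1 f) :
    Integrable f (spikeMeasure d s ∗ _root_.stdGaussian d) :=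
  (integrable_conv_iff hf.continuous.aestronglyMeasurable).2
    ⟨ae_of_all _ hf.integrable_comp_add_stdGaussian, integrable_spikeMeasure s _⟩

theorem half_le_integral_coordMax_spikeMeasure_conv {d : ℕ} (hd : 2 ≤ d) (s : ℝ) :
    s / 2 ≤ ∫ x, coordMax x ∂(spikeMeasure d s ∗ _root_.stdGaussian d) := by
  have : NeZero d := ⟨by omega⟩
  have : Nontrivial (Fin d) := Fin.nontrivial_iff_two_le.2 hd
  rw [integral_conv ((lipschitzWith_coordMax d).integrable_spikeMeasure_conv s),
    integral_spikeMeasure]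
  have h (i : Fin d) :
      s ≤ ∫ x, coordMax (s • EuclideanSpace.single i 1 + x) ∂(_root_.stdGaussian d) +
        ∫ x, coordMax (-(s • EuclideanSpace.single i 1) + x) ∂(_root_.stdGaussian d) := by
    obtain ⟨j, hj⟩ := exists_ne i
    have h1 := eval_le_integral_coordMax_add (s • EuclideanSpace.single i (1 : ℝ)) i
    have h2 := eval_le_integral_coordMax_add (-(s • EuclideanSpace.single i (1 : ℝ))) j
    simp [hj] at h1 h2
    linarith
  have hsum := Finset.sum_le_sum fun i (_ : i ∈ Finset.univ) => h i
  rw [Finset.sum_const, Finset.card_univ, Fintype.card_fin, nsmul_eq_mul] at hsum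
  have hd0 : (0 : ℝ) < d := by positivity
  calc s / 2 = (2 * d : ℝ)⁻¹ * (d * s) := by field_simp
    _ ≤ _ := by gcongr

/-- the spike example lower bound. -/
theorem spike_lower_bound
    (d : ℕ) (hd : 2 ≤ d) (s : ℝ) (hs : 0 < s)
    (μ : Measure (EuclideanSpace ℝ (Fin d)))
    (hμ : μ = ((2 * d : ℝ≥0∞))⁻¹ •
      ∑ i : Fin d,
        (Measure.dirac (s • (EuclideanSpace.single i (1 : ℝ))) +
          Measure.dirac (-(s • (EuclideanSpace.single i (1 : ℝ)))))) :
    covMat μ = (s ^ 2 / d) • (1 : Matrix (Fin d) (Fin d) ℝ) ∧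
    frob (covMat μ) = s ^ 2 / Real.sqrt d ∧
    ENNReal.ofReal (s / 2 - Real.sqrt (2 * Real.log d)) ≤
      Wp 1 (stdGaussian d) (μ ∗ stdGaussian d) ∧
    (4 * Real.sqrt (2 * Real.log d) ≤ s →
      ENNReal.ofReal (s / 4) ≤ Wp 1 (μ ∗ stdGaussian d) (stdGaussian d)) := by
  obtain rfl : μ = spikeMeasure d s := hμ
  have : NeZero d := ⟨by omega⟩
  have hF := lipschitzWith_coordMax d
  have hγ : Integrable coordMax (_root_.stdGaussian d) := by
    simpa using hF.integrable_comp_add_stdGaussian 0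
  have hν := hF.integrable_spikeMeasure_conv s
  have h1 := integral_coordMax_stdGaussian_le hd
  have h2 := half_le_integral_coordMax_spikeMeasure_conv hd s
  refine ⟨covMat_spikeMeasure d s, ?_, ?_, fun hs4 => ?_⟩
  · rw [covMat_spikeMeasure, frob_smul_one (by positivity)]
    have hd0 : (0 : ℝ) < d := by positivity
    field_simp
    rw [Real.sq_sqrt hd0.le]
  · exact (ENNReal.ofReal_mono (by linarith)).trans
      (ofReal_integral_sub_integral_le_Wp_one hF hγ hν)
  · refine (ENNReal.ofReal_mono ?_).trans
      (ofReal_integral_sub_integral_le_Wp_one hF.neg hν.neg hγ.neg)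
    simp only [Pi.neg_apply, integral_neg]
    linarith

end
end

section
/- Let P₀ = N(0,1) and P_δ = (1/2)N(δ,1) + (1/2)N(−δ,1) on ℝ for δ ≥ 0. Then for every p ≥ 1, W_p(P₀, P_δ) ≤ K_p · δ², where K_p = max{1, C_p/2 + 1/3} and C_p = (E_{ξ∼N(0,1)} |ξ|^p)^{1/p}. -/
open MeasureTheory ProbabilityTheory Real ENNReal RealInnerProductSpace

noncomputable section

/-- The cumulative distribution function of the standard Gaussian. -/
noncomputable def gaussCDF (x : ℝ) : ℝ := ∫ t in Set.Iic x, gaussianPDFReal 0 1 t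

/-- The cumulative distribution function of the mixture `(N(s,1) + N(-s,1)) / 2`. -/
noncomputable def mixCDF (s y : ℝ) : ℝ := (gaussCDF (y - s) + gaussCDF (y + s)) / 2

lemma hasDerivAt_gaussCDF (x : ℝ) : HasDerivAt gaussCDF (gaussianPDFReal 0 1 x) x := by
  have hc : Continuous (gaussianPDFReal 0 1) := by
    unfold gaussianPDFReal
    fun_prop
  have hi := integrable_gaussianPDFReal 0 1
  have h : gaussCDF = fun u => gaussCDF 0 + ∫ t in (0 : ℝ)..u, gaussianPDFReal 0 1 t := by
    funext u
    rw [← intervalIntegral.integral_Iic_sub_Iic hi.integrableOn hi.integrableOn]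
    simp [gaussCDF]
  rw [h]
  exact (intervalIntegral.integral_hasDerivAt_right (hc.intervalIntegrable _ _)
    (hc.stronglyMeasurableAtFilter _ _) hc.continuousAt).const_add _

lemma continuous_gaussCDF : Continuous gaussCDF :=
  continuous_iff_continuousAt.2 fun x => (hasDerivAt_gaussCDF x).continuousAt

lemma strictMono_gaussCDF : StrictMono gaussCDF :=
  strictMono_of_deriv_pos fun x => by
    rw [(hasDerivAt_gaussCDF x).deriv]
    exact gaussianPDFReal_pos _ _ _ one_ne_zero

lemma gaussCDF_neg (x : ℝ) : gaussCDF (-x) = 1 - gaussCDF x := by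
  have h1 : gaussCDF (-x) = ∫ t in Set.Ioi x, gaussianPDFReal 0 1 t := by
    have h := integral_comp_neg_Iic (-x) (gaussianPDFReal 0 1)
    rw [neg_neg] at h
    rw [← h, gaussCDF]
    simp [gaussianPDFReal]
  have h2 := integral_add_compl (measurableSet_Iic (a := x)) (integrable_gaussianPDFReal 0 1)
  rw [integral_gaussianPDFReal_eq_one 0 one_ne_zero, Set.compl_Iic, ← h1] at h2
  unfold gaussCDF at *
  linarith

lemma gaussianReal_Iic (m x : ℝ) :
    gaussianReal m 1 (Set.Iic x) = ENNReal.ofReal (gaussCDF (x - m)) := by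
  have h := gaussianReal_map_add_const (μ := 0) (v := 1) m
  rw [zero_add] at h
  rw [← h, Measure.map_apply (by fun_prop) measurableSet_Iic, Set.preimage_add_const_Iic,
    gaussianReal_apply_eq_integral _ one_ne_zero, gaussCDF]

lemma continuous_mixCDF (s : ℝ) : Continuous (mixCDF s) := by
  have := continuous_gaussCDF
  unfold mixCDF
  fun_prop

lemma strictMono_mixCDF (s : ℝ) : StrictMono (mixCDF s) := fun a b hab => by
  have h1 := strictMono_gaussCDF (sub_lt_sub_right hab s)
  have h2 := strictMono_gaussCDF (add_lt_add_left hab s)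
  unfold mixCDF
  linarith

lemma mixCDF_neg (s y : ℝ) : mixCDF s (-y) = 1 - mixCDF s y := by
  have h1 := gaussCDF_neg (y + s)
  have h2 := gaussCDF_neg (y - s)
  rw [show -(y + s) = -y - s by ring] at h1
  rw [show -(y - s) = -y + s by ring] at h2
  unfold mixCDF
  linarith

lemma gaussCDF_sub_le_mixCDF {s : ℝ} (hs : 0 ≤ s) (y : ℝ) : gaussCDF (y - s) ≤ mixCDF s y := by
  have := strictMono_gaussCDF.monotone (show y - s ≤ y + s by linarith)
  unfold mixCDF
  linarith

lemma mixCDF_le_gaussCDF_add {s : ℝ} (hs : 0 ≤ s) (y : ℝ) : mixCDF s y ≤ gaussCDF (y + s) := by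
  have := strictMono_gaussCDF.monotone (show y - s ≤ y + s by linarith)
  unfold mixCDF
  linarith

lemma sinh_le_mul_cosh {u : ℝ} (hu : 0 ≤ u) : Real.sinh u ≤ u * Real.cosh u := by
  have hd : ∀ x : ℝ, HasDerivAt (fun x => x * Real.cosh x - Real.sinh x) (x * Real.sinh x) x :=
    fun x => by
      convert! ((hasDerivAt_id x).mul (Real.hasDerivAt_cosh x)).sub (Real.hasDerivAt_sinh x) using 1
      simp
  have hm : MonotoneOn (fun x => x * Real.cosh x - Real.sinh x) (Set.Ici 0) := by
    refine monotoneOn_of_deriv_nonneg (convex_Ici 0)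
      (fun x _ => (hd x).continuousAt.continuousWithinAt)
      (fun x _ => (hd x).differentiableAt.differentiableWithinAt) fun x hx => ?_
    rw [interior_Ici, Set.mem_Ioi] at hx
    rw [(hd x).deriv]
    exact mul_nonneg hx.le (Real.sinh_nonneg_iff.2 hx.le)
  have := hm Set.self_mem_Ici hu hu
  simp only [zero_mul, Real.sinh_zero, sub_zero] at this
  linarith

lemma gaussianPDFReal_shift (s y : ℝ) :
    gaussianPDFReal 0 1 (y + s) =
      (√(2 * π))⁻¹ * rexp (-(y ^ 2 + s ^ 2) / 2) * rexp (-(s * y)) := by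
  rw [mul_assoc, ← Real.exp_add]
  simp only [gaussianPDFReal, NNReal.coe_one, mul_one]
  ring_nf

lemma gaussianPDFReal_sub_le {s y c : ℝ} (hsy : 0 ≤ s * y) (hc : 1 ≤ c ∨ s * y ≤ c) :
    gaussianPDFReal 0 1 (y - s) - gaussianPDFReal 0 1 (y + s) ≤
      c * (gaussianPDFReal 0 1 (y - s) + gaussianPDFReal 0 1 (y + s)) := by
  rw [sub_eq_add_neg y s, gaussianPDFReal_shift, gaussianPDFReal_shift]
  set A := (√(2 * π))⁻¹ * rexp (-(y ^ 2 + s ^ 2) / 2) with hA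
  have hA0 : 0 ≤ A := by positivity
  have key : Real.sinh (s * y) ≤ c * Real.cosh (s * y) := by
    have hcosh := Real.cosh_pos (s * y)
    rcases hc with hc | hc
    · have := (Real.sinh_lt_cosh (s * y)).le
      nlinarith
    · exact (sinh_le_mul_cosh hsy).trans (by gcongr)
  rw [Real.sinh_eq, Real.cosh_eq] at key
  have e : rexp (-(-s * y)) = rexp (s * y) := by ring_nf
  have e2 : rexp (-((-s) ^ 2 + y ^ 2) / 2) = rexp (-(y ^ 2 + s ^ 2) / 2) := by ring_nf
  rw [neg_sq, ← hA, e]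
  nlinarith [mul_le_mul_of_nonneg_left key hA0]

lemma hasDerivAt_mixCDF_comp {f : ℝ → ℝ} {f' s : ℝ} (hf : HasDerivAt f f' s) :
    HasDerivAt (fun s => mixCDF s (f s))
      ((gaussianPDFReal 0 1 (f s - s) * (f' - 1) + gaussianPDFReal 0 1 (f s + s) * (f' + 1)) / 2)
      s := by
  have h1 := HasDerivAt.comp (h := fun t => f t - t) s (hasDerivAt_gaussCDF (f s - s))
    (hf.sub (hasDerivAt_id s))
  have h2 := HasDerivAt.comp (h := fun t => f t + t) s (hasDerivAt_gaussCDF (f s + s))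
    (hf.add (hasDerivAt_id s))
  exact (h1.add h2).div_const 2

lemma mixCDF_zero (x : ℝ) : mixCDF 0 x = gaussCDF x := by simp [mixCDF]

lemma mixCDF_le_gaussCDF {s x : ℝ} (hs : 0 ≤ s) (hx : 0 ≤ x) : mixCDF s x ≤ gaussCDF x := by
  have hd := fun s : ℝ => hasDerivAt_mixCDF_comp (hasDerivAt_const s x)
  have hm : AntitoneOn (fun s => mixCDF s x) (Set.Ici 0) := by
    refine antitoneOn_of_deriv_nonpos (convex_Ici 0)
      (fun x _ => (hd x).continuousAt.continuousWithinAt)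
      (fun x _ => (hd x).differentiableAt.differentiableWithinAt) fun r hr => ?_
    rw [interior_Ici, Set.mem_Ioi] at hr
    rw [(hd r).deriv]
    have : gaussianPDFReal 0 1 (x + r) ≤ gaussianPDFReal 0 1 (x - r) := by
      simp only [gaussianPDFReal, NNReal.coe_one]
      gcongr _ * rexp (?_ / _)
      nlinarith [mul_nonneg hr.le hx]
    linarith
  simpa [mixCDF_zero] using hm Set.self_mem_Ici hs hs

lemma gaussCDF_le_mixCDF {s x : ℝ} (hs : 0 ≤ s) (hx : 0 ≤ x) :
    gaussCDF x ≤ mixCDF s (x + (s ^ 2 / 2 * x + s ^ 3 / 3)) := by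
  have hf : ∀ s : ℝ, HasDerivAt (fun s : ℝ => x + (s ^ 2 / 2 * x + s ^ 3 / 3))
      (s * x + s ^ 2) s := fun s => by
    have h2 := (((hasDerivAt_pow 2 s).div_const 2).mul_const x)
    have h3 := ((hasDerivAt_pow 3 s).div_const 3)
    convert! (h2.add h3).const_add x using 1
    norm_num
  have hd := fun s : ℝ => hasDerivAt_mixCDF_comp (hf s)
  have hm : MonotoneOn (fun s => mixCDF s (x + (s ^ 2 / 2 * x + s ^ 3 / 3))) (Set.Ici 0) := by
    refine monotoneOn_of_deriv_nonneg (convex_Ici 0)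
      (fun x _ => (hd x).continuousAt.continuousWithinAt)
      (fun x _ => (hd x).differentiableAt.differentiableWithinAt) fun r hr => ?_
    rw [interior_Ici, Set.mem_Ioi] at hr
    rw [(hd r).deriv]
    have h := gaussianPDFReal_sub_le (s := r) (y := x + (r ^ 2 / 2 * x + r ^ 3 / 3))
      (c := r * x + r ^ 2) (by positivity) (by
        by_contra! hcon
        obtain ⟨h1, h2⟩ := hcon
        have h3 : r * (x + r) < r * (x + (r ^ 2 / 2 * x + r ^ 3 / 3)) := by linarith
        have h4 := lt_of_mul_lt_mul_left h3 hr.le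
        have h5 : r * (r ^ 2 / 2 * x + r ^ 3 / 3) ≤ r * r := by
          nlinarith [sq_nonneg r, sq_nonneg (r ^ 2), mul_nonneg hr.le hx]
        nlinarith)
    linarith
  simpa [mixCDF_zero] using hm Set.self_mem_Ici hs hs

/-- The monotone transport from `N(0,1)` to the mixture moves `x` by at most
`s² |x| / 2 + s³ / 3`. -/
lemma exists_mixCDF_eq {s : ℝ} (hs : 0 ≤ s) (x : ℝ) :
    ∃ y, mixCDF s y = gaussCDF x ∧ |x - y| ≤ s ^ 2 / 2 * |x| + s ^ 3 / 3 := by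
  have main : ∀ x : ℝ, 0 ≤ x →
      ∃ y, mixCDF s y = gaussCDF x ∧ |x - y| ≤ s ^ 2 / 2 * |x| + s ^ 3 / 3 := fun x hx => by
    have hle : x ≤ x + (s ^ 2 / 2 * x + s ^ 3 / 3) := le_add_of_nonneg_right (by positivity)
    obtain ⟨y, ⟨hy1, hy2⟩, hy⟩ := intermediate_value_Icc hle (continuous_mixCDF s).continuousOn
      ⟨mixCDF_le_gaussCDF hs hx, gaussCDF_le_mixCDF hs hx⟩
    refine ⟨y, hy, ?_⟩
    rw [abs_of_nonneg hx, abs_le]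
    constructor <;> linarith
  rcases le_total 0 x with hx | hx
  · exact main x hx
  · obtain ⟨y, hy, hb⟩ := main (-x) (by linarith)
    refine ⟨-y, ?_, ?_⟩
    · rw [mixCDF_neg, hy, gaussCDF_neg]
      ring
    · rw [abs_neg, ← abs_neg (-x - y)] at hb
      convert hb using 2
      ring

lemma exists_gaussCDF_eq {s : ℝ} (hs : 0 ≤ s) (y : ℝ) : ∃ z, gaussCDF z = mixCDF s y := by
  obtain ⟨z, -, hz⟩ := intermediate_value_Icc (show y - s ≤ y + s by linarith)
    continuous_gaussCDF.continuousOn ⟨gaussCDF_sub_le_mixCDF hs y, mixCDF_le_gaussCDF_add hs y⟩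
  exact ⟨z, hz⟩

lemma abs_sub_le_of_mixCDF_eq {s x y : ℝ} (hs : 0 ≤ s) (h : mixCDF s y = gaussCDF x) :
    |x - y| ≤ s := by
  have h1 := gaussCDF_sub_le_mixCDF hs y
  have h2 := mixCDF_le_gaussCDF_add hs y
  rw [h, strictMono_gaussCDF.le_iff_le] at h1 h2
  rw [abs_le]
  constructor <;> linarith

lemma gaussCDF_nonneg (x : ℝ) : 0 ≤ gaussCDF x :=
  integral_nonneg fun _ => gaussianPDFReal_nonneg _ _ _

/-- A map matching the distribution functions transports `N(0,1)` to the mixture. -/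
lemma map_gaussianReal_eq_mixture {s : ℝ} (hs : 0 ≤ s) {T : ℝ → ℝ} (hTm : Measurable T)
    (hT : ∀ x, mixCDF s (T x) = gaussCDF x) :
    (gaussianReal 0 1).map T =
      (2 : ℝ≥0∞)⁻¹ • gaussianReal s 1 + (2 : ℝ≥0∞)⁻¹ • gaussianReal (-s) 1 := by
  refine Measure.ext_of_Iic _ _ fun y => ?_
  obtain ⟨z, hz⟩ := exists_gaussCDF_eq hs y
  have hpre : T ⁻¹' Set.Iic y = Set.Iic z := by
    ext x
    rw [Set.mem_preimage, Set.mem_Iic, Set.mem_Iic, ← (strictMono_mixCDF s).le_iff_le, hT, ← hz,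
      strictMono_gaussCDF.le_iff_le]
  have h2 : (2 : ℝ≥0∞)⁻¹ = ENNReal.ofReal 2⁻¹ := by
    rw [ENNReal.ofReal_inv_of_pos two_pos, ENNReal.ofReal_ofNat]
  rw [Measure.map_apply hTm measurableSet_Iic, hpre, gaussianReal_Iic, sub_zero, hz,
    Measure.add_apply, Measure.smul_apply, Measure.smul_apply, gaussianReal_Iic, gaussianReal_Iic,
    smul_eq_mul, smul_eq_mul, h2, ← ENNReal.ofReal_mul (by norm_num),
    ← ENNReal.ofReal_mul (by norm_num), ← ENNReal.ofReal_add, sub_neg_eq_add, mixCDF]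
  · ring_nf
  · exact mul_nonneg (by norm_num) (gaussCDF_nonneg _)
  · exact mul_nonneg (by norm_num) (gaussCDF_nonneg _)

/-- A transport map bounds the Wasserstein distance. -/
lemma Wp_map_le {E : Type*} [MeasurableSpace E] [NormedAddCommGroup E] {p : ℝ} (hp : 0 ≤ p)
    (μ : Measure E) {T : E → E} (hT : Measurable T) {g : E → ℝ} (hg : ∀ x, ‖x - T x‖ ≤ g x) :
    Wp p μ (μ.map T) ≤ (∫⁻ x, ENNReal.ofReal (g x) ^ p ∂μ) ^ (1 / p) := by
  have hm : Measurable fun x => (x, T x) := measurable_id.prodMk hT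
  have hmem : μ.map (fun x => (x, T x)) ∈ couplings μ (μ.map T) := by
    refine ⟨?_, ?_⟩
    · rw [Measure.map_map measurable_fst hm]
      exact Measure.map_id
    · rw [Measure.map_map measurable_snd hm]
      rfl
  refine ENNReal.rpow_le_rpow ((iInf₂_le _ hmem).trans ?_) (by positivity)
  refine (lintegral_map_le _ _).trans (lintegral_mono fun x => ?_)
  rw [← ENNReal.ofReal_rpow_of_nonneg (norm_nonneg _) hp]
  exact ENNReal.rpow_le_rpow (ENNReal.ofReal_le_ofReal (hg x)) hp

lemma lintegral_abs_rpow_gaussianReal {p : ℝ} (hp : 1 ≤ p) :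
    (∫⁻ x, ENNReal.ofReal |x| ^ p ∂(gaussianReal 0 1)) ^ (1 / p) = ENNReal.ofReal (Cconst p) := by
  have hp0 : 0 < p := by linarith
  have hint : Integrable (fun x : ℝ => |x| ^ p) (gaussianReal 0 1) := by
    have h := (memLp_id_gaussianReal' (μ := 0) (v := 1) (ENNReal.ofReal p)
      ENNReal.ofReal_ne_top).integrable_norm_rpow'
    simpa [ENNReal.toReal_ofReal hp0.le] using h
  have hnn : ∀ x : ℝ, 0 ≤ |x| ^ p := fun x => by positivity
  rw [Cconst, ← ENNReal.ofReal_rpow_of_nonneg (integral_nonneg hnn) (by positivity),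
    ofReal_integral_eq_lintegral_ofReal hint (ae_of_all _ hnn)]
  simp_rw [ENNReal.ofReal_rpow_of_nonneg (abs_nonneg _) hp0.le]

lemma Cconst_nonneg (p : ℝ) : 0 ≤ Cconst p :=
  Real.rpow_nonneg (integral_nonneg fun _ => by positivity) _

lemma lintegral_affine_rpow_gaussianReal_le {p a b : ℝ} (hp : 1 ≤ p) (ha : 0 ≤ a) (hb : 0 ≤ b) :
    (∫⁻ x, ENNReal.ofReal (a * |x| + b) ^ p ∂(gaussianReal 0 1)) ^ (1 / p) ≤
      ENNReal.ofReal (a * Cconst p + b) := by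
  have hp0 : 0 < p := by linarith
  have h := ENNReal.lintegral_Lp_add_le (μ := gaussianReal 0 1) (p := p)
    (f := fun x => ENNReal.ofReal (a * |x|)) (g := fun _ => ENNReal.ofReal b)
    (by fun_prop) (by fun_prop) hp
  have e1 : (∫⁻ x, ENNReal.ofReal (a * |x|) ^ p ∂(gaussianReal 0 1)) ^ (1 / p) =
      ENNReal.ofReal (a * Cconst p) := by
    simp_rw [ENNReal.ofReal_mul ha, ENNReal.mul_rpow_of_nonneg _ _ hp0.le]
    rw [lintegral_const_mul _ (by fun_prop), ENNReal.mul_rpow_of_nonneg _ _ (by positivity),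
      lintegral_abs_rpow_gaussianReal hp, one_div, ENNReal.rpow_rpow_inv hp0.ne']
  have e2 : (∫⁻ _, ENNReal.ofReal b ^ p ∂(gaussianReal 0 1)) ^ (1 / p) = ENNReal.ofReal b := by
    rw [lintegral_const, measure_univ, mul_one, one_div, ENNReal.rpow_rpow_inv hp0.ne']
  rw [e1, e2, ← ENNReal.ofReal_add (mul_nonneg ha (Cconst_nonneg p)) hb] at h
  refine le_trans (le_of_eq ?_) h
  congr 2
  funext x
  rw [Pi.add_apply, ← ENNReal.ofReal_add (by positivity) hb]

/-- Wasserstein-`p` distance between a standard Gaussian and a symmetric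
two-component Gaussian mixture on `ℝ`. -/
theorem wasserstein_two_component_mixture_1d
    (δ : ℝ) (hδ : 0 ≤ δ) (p : ℝ) (hp : 1 ≤ p) :
    Wp p (gaussianReal 0 1)
        ((2 : ℝ≥0∞)⁻¹ • gaussianReal δ 1 + (2 : ℝ≥0∞)⁻¹ • gaussianReal (-δ) 1) ≤
      ENNReal.ofReal (Kconst p * δ ^ 2) := by
  choose T hT hTb using exists_mixCDF_eq hδ
  have hTm : Measurable T := by
    refine Monotone.measurable fun a b hab => ?_
    rw [← (strictMono_mixCDF δ).le_iff_le, hT, hT]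
    exact strictMono_gaussCDF.monotone hab
  have hp0 : 0 ≤ p := by linarith
  rw [← map_gaussianReal_eq_mixture hδ hTm hT]
  rcases le_total δ 1 with h1 | h1
  · refine (Wp_map_le hp0 _ hTm hTb).trans
      ((lintegral_affine_rpow_gaussianReal_le hp (by positivity) (by positivity)).trans
        (ENNReal.ofReal_le_ofReal ?_))
    calc δ ^ 2 / 2 * Cconst p + δ ^ 3 / 3 ≤ (Cconst p / 2 + 1 / 3) * δ ^ 2 := by
          nlinarith [mul_le_mul_of_nonneg_left h1 (sq_nonneg δ)]
      _ ≤ Kconst p * δ ^ 2 := by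
          gcongr
          exact le_max_right _ _
  · have hb : ∀ x, ‖x - T x‖ ≤ 0 * |x| + δ := fun x => by
      simpa using abs_sub_le_of_mixCDF_eq hδ (hT x)
    refine (Wp_map_le hp0 _ hTm hb).trans
      ((lintegral_affine_rpow_gaussianReal_le hp le_rfl hδ).trans
        (ENNReal.ofReal_le_ofReal ?_))
    have : 1 ≤ Kconst p := le_max_left _ _
    nlinarith [mul_le_mul_of_nonneg_right this (sq_nonneg δ)]

end
end

section
/- Fix n ∈ ℕ, p ≥ 1, and points x₁, …, x_{2n} ∈ ℝ^d with Σ_{i=1}^{2n} x_i = 0. Then there exists a perfect matching M of {1, …, 2n} into n disjoint pairs such that Σ_{(i,j)∈M} ‖x_i − x_j‖^{2p} ≥ (n/(2n−1)) Σ_{i=1}^{2n} ‖x_i‖^{2p} ≥ (1/2) Σ_{i=1}^{2n} ‖x_i‖^{2p}. -/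
open MeasureTheory ProbabilityTheory Real ENNReal RealInnerProductSpace

noncomputable section

/-- Double counting: the matchings obtained by conjugating a fixed-point-free map `τ` by
permutations cover every off-diagonal pair equally often, so one of them does at least as well
as the average. -/
theorem exists_perm_sum_le_card_sub_one_mul {α : Type*} [Fintype α] [DecidableEq α]
    (τ : α → α) (hτ : ∀ i, τ i ≠ i) (f : α → α → ℝ) (hf : ∀ i, f i i = 0) :
    ∃ σ : Equiv.Perm α,
      ∑ i, ∑ j, f i j ≤ ((Fintype.card α : ℝ) - 1) * ∑ k, f (σ k) (σ (τ k)) := by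
  have hconst (k l : α) (hl : l ≠ k) :
      ∑ σ : Equiv.Perm α, f (σ k) (σ l) = ∑ σ : Equiv.Perm α, f (σ k) (σ (τ k)) := by
    rw [← Equiv.sum_comp (Equiv.mulRight (Equiv.swap l (τ k)))
      fun σ : Equiv.Perm α => f (σ k) (σ (τ k))]
    simp [Equiv.swap_apply_of_ne_of_ne hl.symm (hτ k).symm]
  have hrow (k : α) : ∑ l, ∑ σ : Equiv.Perm α, f (σ k) (σ l) =
      ((Fintype.card α : ℝ) - 1) * ∑ σ : Equiv.Perm α, f (σ k) (σ (τ k)) := by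
    rw [← Finset.add_sum_erase _ _ (Finset.mem_univ k),
      Finset.sum_congr rfl fun l hl => hconst k l (Finset.ne_of_mem_erase hl)]
    have : 1 ≤ Fintype.card α := Fintype.card_pos_iff.mpr ⟨k⟩
    simp [hf, Finset.card_erase_of_mem, Nat.cast_sub this]
  have htotal : ∑ σ : Equiv.Perm α, ∑ i, ∑ j, f i j =
      ∑ σ : Equiv.Perm α, ((Fintype.card α : ℝ) - 1) * ∑ k, f (σ k) (σ (τ k)) := by
    rw [← Finset.mul_sum, Finset.sum_comm (f := fun (σ : Equiv.Perm α) k => f (σ k) (σ (τ k))),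
      Finset.mul_sum, ← Finset.sum_congr rfl fun k _ => hrow k]
    simp_rw [Finset.sum_comm (s := Finset.univ (α := α)) (t := Finset.univ (α := Equiv.Perm α))]
    refine Finset.sum_congr rfl fun σ _ => ?_
    rw [← Equiv.sum_comp σ fun i => ∑ j, f i j]
    exact Finset.sum_congr rfl fun k _ => (Equiv.sum_comp σ _).symm
  obtain ⟨σ, -, hσ⟩ := Finset.exists_le_of_sum_le Finset.univ_nonempty htotal.le
  exact ⟨σ, hσ⟩

/-- Jensen's inequality for the `q`-th power of the distance to a centred finite family. -/
theorem card_mul_norm_rpow_le_sum_norm_sub_rpow {α E : Type*} [Fintype α]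
    [SeminormedAddCommGroup E] [NormedSpace ℝ E] (x : α → E) (hsum : ∑ i, x i = 0)
    {q : ℝ} (hq : 1 ≤ q) (y : E) :
    (Fintype.card α : ℝ) * ‖y‖ ^ q ≤ ∑ j, ‖y - x j‖ ^ q := by
  rcases isEmpty_or_nonempty α with _ | _
  · simp
  have hN : (0 : ℝ) < Fintype.card α := by exact_mod_cast Fintype.card_pos
  have hy : ‖y‖ ≤ ∑ j, (Fintype.card α : ℝ)⁻¹ * ‖y - x j‖ := by
    have h : (Fintype.card α : ℝ) • y = ∑ j, (y - x j) := by
      simp [Finset.sum_sub_distrib, hsum, Nat.cast_smul_eq_nsmul]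
    have h' := norm_sum_le Finset.univ fun j => y - x j
    rw [← h, norm_smul, Real.norm_of_nonneg hN.le] at h'
    rwa [← Finset.mul_sum, le_inv_mul_iff₀ hN]
  have hJ := Real.rpow_arith_mean_le_arith_mean_rpow Finset.univ
    (fun _ : α => (Fintype.card α : ℝ)⁻¹) (fun j => ‖y - x j‖) (fun _ _ => by positivity)
    (by simp [hN.ne']) (fun _ _ => norm_nonneg _) hq
  have h := (Real.rpow_le_rpow (norm_nonneg y) hy (by linarith)).trans hJ
  rwa [← Finset.mul_sum, le_inv_mul_iff₀ hN] at h

/-- existence of a large-energy perfect matching. -/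
theorem exists_large_energy_matching
    (n : ℕ) (hn : 0 < n) (d : ℕ) (p : ℝ) (hp : 1 ≤ p)
    (x : Fin (2 * n) → EuclideanSpace ℝ (Fin d))
    (hsum : ∑ i, x i = 0) :
    ∃ M : Fin (2 * n) → Fin (2 * n), Function.Involutive M ∧ (∀ i, M i ≠ i) ∧
      ((n : ℝ) / (2 * n - 1)) * ∑ i, ‖x i‖ ^ (2 * p) ≤
        (1 / 2) * ∑ i, ‖x i - x (M i)‖ ^ (2 * p) ∧
      (1 / 2) * ∑ i, ‖x i‖ ^ (2 * p) ≤
        ((n : ℝ) / (2 * n - 1)) * ∑ i, ‖x i‖ ^ (2 * p) := by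
  have hn' : (1 : ℝ) ≤ n := by exact_mod_cast hn
  have hpos : (0 : ℝ) < 2 * n - 1 := by linarith
  have hrev (i : Fin (2 * n)) : i.rev ≠ i := by
    intro h
    have := congrArg Fin.val h
    rw [Fin.val_rev] at this
    omega
  obtain ⟨σ, hσ⟩ := exists_perm_sum_le_card_sub_one_mul Fin.rev hrev
    (fun i j => ‖x i - x j‖ ^ (2 * p))
    fun i => by rw [sub_self, norm_zero, Real.zero_rpow (by linarith)]
  refine ⟨fun i => σ (σ.symm i).rev, fun i => by simp, fun i h => ?_, ?_, ?_⟩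
  · exact hrev (σ.symm i) (σ.injective (by simpa using h))
  · rw [← Equiv.sum_comp σ fun i => ‖x i - x (σ (σ.symm i).rev)‖ ^ (2 * p)]
    have hJ := Finset.sum_le_sum fun i (_ : i ∈ Finset.univ) =>
      card_mul_norm_rpow_le_sum_norm_sub_rpow x hsum (q := 2 * p) (by linarith) (x i)
    rw [← Finset.mul_sum] at hJ
    have h := hJ.trans hσ
    simp only [Fintype.card_fin, Nat.cast_mul, Nat.cast_ofNat] at h
    simp only [Equiv.symm_apply_apply]
    rw [div_mul_eq_mul_div, div_le_iff₀ hpos]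
    linarith
  · refine mul_le_mul_of_nonneg_right ?_
      (Finset.sum_nonneg fun i _ => Real.rpow_nonneg (norm_nonneg _) _)
    rw [le_div_iff₀ hpos]
    linarith

end
end

section
/- Fix p ≥ 1, n ∈ ℕ, and points x₁, …, x_{2n} ∈ ℝ^d. Let M be a perfect matching of {1, …, 2n} such that Σ_{(i,j)∈M} ‖x_i − x_j‖^{2p} ≥ (1/2) Σ_{i=1}^{2n} ‖x_i‖^{2p}, and let y₁, …, y_{2n} be obtained by midpoint replacement along M, i.e. y_i = y_j = (x_i + x_j)/2 for each pair (i,j) ∈ M. Then (1/(2n)) Σ_{i=1}^{2n} ‖y_i‖^{2p} ≤ (1 − 2^{−2p}) · (1/(2n)) Σ_{i=1}^{2n} ‖x_i‖^{2p}. -/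
open MeasureTheory ProbabilityTheory Real ENNReal RealInnerProductSpace

noncomputable section

/-- Clarkson's inequality in an inner product space, for exponents `2 * p ≥ 2`. -/
theorem norm_midpoint_rpow_add_norm_half_sub_rpow_le
    {E : Type*} [NormedAddCommGroup E] [InnerProductSpace ℝ E]
    {p : ℝ} (hp : 1 ≤ p) (a b : E) :
    ‖(2 : ℝ)⁻¹ • (a + b)‖ ^ (2 * p) + (2 : ℝ) ^ (-(2 * p)) * ‖a - b‖ ^ (2 * p) ≤
      (1 / 2) * (‖a‖ ^ (2 * p) + ‖b‖ ^ (2 * p)) := by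
  have sq_rpow (t : ℝ) (ht : 0 ≤ t) : t ^ (2 * p) = (t ^ 2) ^ p := by
    rw [Real.rpow_mul ht, Real.rpow_two]
  have scale : (2 : ℝ) ^ (-(2 * p)) * ‖a - b‖ ^ (2 * p) =
      ‖(2 : ℝ)⁻¹ • (a - b)‖ ^ (2 * p) := by
    rw [norm_smul, Real.mul_rpow (norm_nonneg _) (norm_nonneg _), Real.norm_of_nonneg (by norm_num),
      Real.rpow_neg (by norm_num), Real.inv_rpow (by norm_num)]
  have parallelogram : ‖(2 : ℝ)⁻¹ • (a + b)‖ ^ 2 + ‖(2 : ℝ)⁻¹ • (a - b)‖ ^ 2 =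
      (1 / 2) * ‖a‖ ^ 2 + (1 / 2) * ‖b‖ ^ 2 := by
    rw [norm_smul, norm_smul, Real.norm_of_nonneg (by norm_num)]
    linear_combination (1 / 4) * parallelogram_law_with_norm ℝ a b
  rw [scale, sq_rpow _ (norm_nonneg _), sq_rpow _ (norm_nonneg _), sq_rpow _ (norm_nonneg _),
    sq_rpow _ (norm_nonneg _)]
  calc _ ≤ (‖(2 : ℝ)⁻¹ • (a + b)‖ ^ 2 + ‖(2 : ℝ)⁻¹ • (a - b)‖ ^ 2) ^ p :=
        Real.add_rpow_le_rpow_add (sq_nonneg _) (sq_nonneg _) hp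
    _ = ((1 / 2) * ‖a‖ ^ 2 + (1 / 2) * ‖b‖ ^ 2) ^ p := by rw [parallelogram]
    _ ≤ (1 / 2) * (‖a‖ ^ 2) ^ p + (1 / 2) * (‖b‖ ^ 2) ^ p :=
        (convexOn_rpow hp).2 (sq_nonneg ‖a‖) (sq_nonneg ‖b‖) (by norm_num) (by norm_num)
          (by norm_num)
    _ = _ := by ring

/-- midpoint replacement along a large-energy matching contracts the
`2p`-th empirical moment. -/
theorem midpoint_moment_contraction
    (n : ℕ) (hn : 0 < n) (d : ℕ) (p : ℝ) (hp : 1 ≤ p)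
    (x : Fin (2 * n) → EuclideanSpace ℝ (Fin d))
    (M : Fin (2 * n) → Fin (2 * n))
    (hM : Function.Involutive M) (hMfix : ∀ i, M i ≠ i)
    (henergy : (1 / 2) * ∑ i, ‖x i‖ ^ (2 * p) ≤
      (1 / 2) * ∑ i, ‖x i - x (M i)‖ ^ (2 * p))
    (y : Fin (2 * n) → EuclideanSpace ℝ (Fin d))
    (hy : ∀ i, y i = (2 : ℝ)⁻¹ • (x i + x (M i))) :
    (1 / (2 * n)) * ∑ i, ‖y i‖ ^ (2 * p) ≤
      (1 - (2 : ℝ) ^ (-(2 * p))) * ((1 / (2 * n)) * ∑ i, ‖x i‖ ^ (2 * p)) := by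
  have reindex : ∑ i, ‖x (M i)‖ ^ (2 * p) = ∑ i, ‖x i‖ ^ (2 * p) :=
    Equiv.sum_comp hM.toPerm fun i => ‖x i‖ ^ (2 * p)
  have clarkson : ∑ i, ‖y i‖ ^ (2 * p) +
      (2 : ℝ) ^ (-(2 * p)) * ∑ i, ‖x i - x (M i)‖ ^ (2 * p) ≤ ∑ i, ‖x i‖ ^ (2 * p) := by
    calc _ = ∑ i, (‖y i‖ ^ (2 * p) + (2 : ℝ) ^ (-(2 * p)) * ‖x i - x (M i)‖ ^ (2 * p)) := by
          rw [Finset.sum_add_distrib, Finset.mul_sum]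
      _ ≤ ∑ i, (1 / 2) * (‖x i‖ ^ (2 * p) + ‖x (M i)‖ ^ (2 * p)) := by
          refine Finset.sum_le_sum fun i _ => ?_
          rw [hy i]
          exact norm_midpoint_rpow_add_norm_half_sub_rpow_le hp _ _
      _ = _ := by
          rw [← Finset.mul_sum, Finset.sum_add_distrib, reindex]
          ring
  have energy := mul_le_mul_of_nonneg_left (le_of_mul_le_mul_left henergy (by norm_num))
    (by positivity : (0 : ℝ) ≤ (2 : ℝ) ^ (-(2 * p)))
  rw [mul_left_comm]
  refine mul_le_mul_of_nonneg_left ?_ (by positivity)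
  linarith

end
end

section
/- Fix n ∈ ℕ, p ≥ 1, points x₁, …, x_{2n} ∈ ℝ^d, and a perfect matching M of {1, …, 2n}. Let y₁, …, y_{2n} be obtained by midpoint replacement along M (y_i = y_j = (x_i + x_j)/2 for (i,j) ∈ M), and define the Gaussian mixtures μ_x = (1/(2n)) Σ_{i=1}^{2n} N(x_i, I_d) and μ_y = (1/(2n)) Σ_{i=1}^{2n} N(y_i, I_d). Then W_p(μ_x, μ_y) ≤ (K_p/4) · ((1/n) Σ_{(i,j)∈M} ‖x_i − x_j‖^{2p})^{1/p} ≤ K_p · ((1/(2n)) Σ_{i=1}^{2n} ‖x_i‖^{2p})^{1/p}, where K_p = max{1, C_p/2 + 1/3} and C_p = (E_{ξ∼N(0,1)} |ξ|^p)^{1/p}. -/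
open MeasureTheory ProbabilityTheory Real ENNReal RealInnerProductSpace

noncomputable section

/-- The primitive of the standard Gaussian density vanishing at the origin. -/
def gaussPrimitive (x : ℝ) : ℝ := ∫ t in (0 : ℝ)..x, gaussianPDFReal 0 1 t

/-- The centred distribution function of the symmetric mixture `½ N(-a,1) + ½ N(a,1)`. -/
def mixPrimitive (a x : ℝ) : ℝ := (gaussPrimitive (x - a) + gaussPrimitive (x + a)) / 2

lemma continuous_gaussianPDFReal_std : Continuous (gaussianPDFReal 0 1) := by
  unfold gaussianPDFReal
  fun_prop

lemma hasDerivAt_gaussPrimitive (x : ℝ) :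
    HasDerivAt gaussPrimitive (gaussianPDFReal 0 1 x) x :=
  intervalIntegral.integral_hasDerivAt_right
    (continuous_gaussianPDFReal_std.intervalIntegrable _ _)
    (continuous_gaussianPDFReal_std.stronglyMeasurableAtFilter _ _)
    continuous_gaussianPDFReal_std.continuousAt

lemma gaussianPDFReal_std_neg (x : ℝ) : gaussianPDFReal 0 1 (-x) = gaussianPDFReal 0 1 x := by
  simp [gaussianPDFReal]

lemma gaussPrimitive_neg (x : ℝ) : gaussPrimitive (-x) = -gaussPrimitive x := by
  have h := intervalIntegral.integral_comp_neg (a := 0) (b := x) (gaussianPDFReal 0 1)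
  simp only [gaussianPDFReal_std_neg, neg_zero] at h
  rw [gaussPrimitive, gaussPrimitive, h, intervalIntegral.integral_symm]

lemma strictMono_gaussPrimitive : StrictMono gaussPrimitive :=
  strictMono_of_deriv_pos fun x => by
    rw [(hasDerivAt_gaussPrimitive x).deriv]
    exact gaussianPDFReal_pos 0 1 x one_ne_zero

lemma continuous_gaussPrimitive : Continuous gaussPrimitive :=
  continuous_iff_continuousAt.2 fun x => (hasDerivAt_gaussPrimitive x).continuousAt

lemma mixPrimitive_neg (a x : ℝ) : mixPrimitive a (-x) = -mixPrimitive a x := by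
  rw [mixPrimitive, mixPrimitive, show -x - a = -(x + a) by ring,
    show -x + a = -(x - a) by ring, gaussPrimitive_neg, gaussPrimitive_neg]
  ring

lemma strictMono_mixPrimitive (a : ℝ) : StrictMono (mixPrimitive a) := by
  intro x y hxy
  have h₁ := strictMono_gaussPrimitive (sub_lt_sub_right hxy a)
  have h₂ := strictMono_gaussPrimitive (add_lt_add_left hxy a)
  unfold mixPrimitive
  linarith

lemma continuous_mixPrimitive (a : ℝ) : Continuous (mixPrimitive a) := by
  have := continuous_gaussPrimitive
  unfold mixPrimitive
  fun_prop

lemma mixPrimitive_zero (x : ℝ) : mixPrimitive 0 x = gaussPrimitive x := by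
  simp [mixPrimitive]

lemma one_sub_mul_exp_le {h : ℝ} (hh : 0 ≤ h) :
    (1 - h) * exp h ≤ (1 + h) * exp (-h) := by
  have hd : ∀ t : ℝ, HasDerivAt (fun t => (1 + t) * exp (-t) - (1 - t) * exp t)
      (t * (exp t - exp (-t))) t := fun t => by
    have h₁ := ((hasDerivAt_id t).const_add 1).mul (hasDerivAt_neg t).exp
    have h₂ := ((hasDerivAt_id t).const_sub 1).mul (Real.hasDerivAt_exp t)
    refine (h₁.sub h₂).congr_deriv ?_
    simp only [id]
    ring
  have hm : MonotoneOn (fun t : ℝ => (1 + t) * exp (-t) - (1 - t) * exp t) (Set.Ici 0) := by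
    refine monotoneOn_of_deriv_nonneg (convex_Ici 0)
      (fun t _ => (hd t).continuousAt.continuousWithinAt)
      (fun t _ => (hd t).differentiableAt.differentiableWithinAt) fun t ht => ?_
    rw [interior_Ici, Set.mem_Ioi] at ht
    rw [(hd t).deriv]
    exact mul_nonneg ht.le (sub_nonneg.2 (exp_le_exp.2 (by linarith)))
  have := hm (Set.self_mem_Ici) (Set.mem_Ici.2 hh) hh
  simp only [add_zero, neg_zero, exp_zero, sub_zero, mul_one, sub_self] at this
  linarith

lemma gaussianPDFReal_std_add (g s : ℝ) :
    gaussianPDFReal 0 1 (g + s) = gaussianPDFReal 0 1 (g - s) * exp (-(2 * (s * g))) := by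
  simp only [gaussianPDFReal, NNReal.coe_one, mul_one, sub_zero]
  rw [mul_assoc, ← exp_add]
  congr 2
  ring

lemma gaussianPDFReal_std_sub_mul_le {g s h : ℝ} (hh : 0 ≤ h) (hg : h < 1 → s * g ≤ h) :
    gaussianPDFReal 0 1 (g - s) * (1 - h) ≤ gaussianPDFReal 0 1 (g + s) * (1 + h) := by
  have h₀ := gaussianPDFReal_nonneg 0 1 (g - s)
  rcases lt_or_ge h 1 with h1 | h1
  · rw [gaussianPDFReal_std_add, mul_assoc]
    refine mul_le_mul_of_nonneg_left ?_ h₀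
    have h₁ := mul_le_mul_of_nonneg_right (one_sub_mul_exp_le hh) (exp_pos (-h)).le
    have h₂ : exp (-h) * exp (-h) ≤ exp (-(2 * (s * g))) := by
      rw [← exp_add]
      exact exp_le_exp.2 (by linarith [hg h1])
    rw [mul_assoc, mul_assoc, ← exp_add, add_neg_cancel, exp_zero, mul_one] at h₁
    nlinarith
  · have h₂ := gaussianPDFReal_nonneg 0 1 (g + s)
    exact (mul_nonpos_of_nonneg_of_nonpos h₀ (by linarith)).trans
      (mul_nonneg h₂ (by linarith))

lemma mixPrimitive_le {a x : ℝ} (ha : 0 ≤ a) (hx : 0 ≤ x) :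
    mixPrimitive a x ≤ gaussPrimitive x := by
  have hd : ∀ s : ℝ, HasDerivAt (fun s => mixPrimitive s x)
      ((gaussianPDFReal 0 1 (x - s) * (-1) + gaussianPDFReal 0 1 (x + s) * 1) / 2) s := fun s =>
    (((hasDerivAt_gaussPrimitive _).comp s ((hasDerivAt_id s).const_sub x)).add
      ((hasDerivAt_gaussPrimitive _).comp s ((hasDerivAt_id s).const_add x))).div_const 2
  have hm : AntitoneOn (fun s => mixPrimitive s x) (Set.Ici 0) := by
    refine antitoneOn_of_deriv_nonpos (convex_Ici 0)
      (fun t _ => (hd t).continuousAt.continuousWithinAt)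
      (fun t _ => (hd t).differentiableAt.differentiableWithinAt) fun t ht => ?_
    rw [interior_Ici, Set.mem_Ioi] at ht
    have : gaussianPDFReal 0 1 (x + t) ≤ gaussianPDFReal 0 1 (x - t) := by
      rw [gaussianPDFReal_std_add]
      exact mul_le_of_le_one_right (gaussianPDFReal_nonneg _ _ _)
        (exp_le_one_iff.2 (by nlinarith))
    rw [(hd t).deriv]
    linarith
  have := hm Set.self_mem_Ici (Set.mem_Ici.2 ha) ha
  simpa only [mixPrimitive_zero] using this

lemma le_mixPrimitive {a x : ℝ} (ha : 0 ≤ a) (hx : 0 ≤ x) :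
    gaussPrimitive x ≤ mixPrimitive a (x + (a ^ 2 / 2 * x + a ^ 3 / 3)) := by
  set g : ℝ → ℝ := fun s => x + (s ^ 2 / 2 * x + s ^ 3 / 3) with hg
  have hgd : ∀ s, HasDerivAt g (s * (x + s)) s := fun s => by
    have h₁ := ((hasDerivAt_pow 2 s).div_const 2).mul_const x
    have h₂ := (hasDerivAt_pow 3 s).div_const 3
    refine ((h₁.add h₂).const_add x).congr_deriv ?_
    norm_num
    ring
  have hd : ∀ s : ℝ, HasDerivAt (fun s => mixPrimitive s (g s))
      ((gaussianPDFReal 0 1 (g s - s) * (s * (x + s) - 1)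
        + gaussianPDFReal 0 1 (g s + s) * (s * (x + s) + 1)) / 2) s := fun s =>
    (((hasDerivAt_gaussPrimitive _).comp s ((hgd s).sub (hasDerivAt_id s))).add
      ((hasDerivAt_gaussPrimitive _).comp s ((hgd s).add (hasDerivAt_id s)))).div_const 2
  have hm : MonotoneOn (fun s => mixPrimitive s (g s)) (Set.Ici 0) := by
    refine monotoneOn_of_deriv_nonneg (convex_Ici 0)
      (fun t _ => (hd t).continuousAt.continuousWithinAt)
      (fun t _ => (hd t).differentiableAt.differentiableWithinAt) fun s hs => ?_
    rw [interior_Ici, Set.mem_Ioi] at hs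
    have : gaussianPDFReal 0 1 (g s - s) * (1 - s * (x + s))
        ≤ gaussianPDFReal 0 1 (g s + s) * (1 + s * (x + s)) := by
      refine gaussianPDFReal_std_sub_mul_le (by positivity) fun h1 => ?_
      refine mul_le_mul_of_nonneg_left ?_ hs.le
      have h2 : s ^ 2 / 2 * x + s ^ 3 / 3 = s * (s * (x + s) / 2 - s ^ 2 / 6) := by ring
      have h3 : s * (x + s) / 2 - s ^ 2 / 6 ≤ 1 := by nlinarith [sq_nonneg s]
      simp only [hg, h2]
      nlinarith
    rw [(hd s).deriv]
    linarith
  have := hm Set.self_mem_Ici (Set.mem_Ici.2 ha) ha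
  simpa [hg, mixPrimitive_zero] using this

lemma exists_mixPrimitive_eq {a : ℝ} (ha : 0 ≤ a) (x : ℝ) :
    ∃ t, mixPrimitive a t = gaussPrimitive x ∧ |t - x| ≤ a := by
  have h₁ : mixPrimitive a (x - a) ≤ gaussPrimitive x := by
    have := strictMono_gaussPrimitive.monotone (show x - a - a ≤ x by linarith)
    simp only [mixPrimitive, sub_add_cancel]
    linarith
  have h₂ : gaussPrimitive x ≤ mixPrimitive a (x + a) := by
    have := strictMono_gaussPrimitive.monotone (show x ≤ x + a + a by linarith)
    simp only [mixPrimitive, add_sub_cancel_right]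
    linarith
  obtain ⟨t, ⟨ht₁, ht₂⟩, ht⟩ := intermediate_value_Icc (show x - a ≤ x + a by linarith)
    (continuous_mixPrimitive a).continuousOn ⟨h₁, h₂⟩
  exact ⟨t, ht, abs_le.2 ⟨by linarith, by linarith⟩⟩

lemma abs_sub_le_of_mixPrimitive_eq {a x t : ℝ} (ha : 0 ≤ a)
    (h : mixPrimitive a t = gaussPrimitive x) : |t - x| ≤ a ^ 2 / 2 * |x| + a ^ 3 / 3 := by
  wlog hx : 0 ≤ x generalizing x t
  · have := this (x := -x) (t := -t) (by rw [mixPrimitive_neg, gaussPrimitive_neg, h])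
      (by linarith)
    rwa [abs_neg, ← neg_sub', abs_neg] at this
  have h₁ := (strictMono_mixPrimitive a).le_iff_le.1 ((mixPrimitive_le ha hx).trans_eq h.symm)
  have h₂ := (strictMono_mixPrimitive a).le_iff_le.1 (h.trans_le (le_mixPrimitive ha hx))
  rw [abs_of_nonneg (sub_nonneg.2 h₁), abs_of_nonneg hx]
  linarith

lemma gaussianReal_real_Iic (x : ℝ) :
    (gaussianReal 0 1).real (Set.Iic x) = (gaussianReal 0 1).real (Set.Iic 0)
      + gaussPrimitive x := by
  have h : ∀ y : ℝ, (gaussianReal 0 1).real (Set.Iic y)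
      = ∫ t in Set.Iic y, gaussianPDFReal 0 1 t := fun y => by
    rw [measureReal_def, gaussianReal_apply_eq_integral _ one_ne_zero,
      ENNReal.toReal_ofReal (integral_nonneg fun t => gaussianPDFReal_nonneg _ _ _)]
  have hi := integrable_gaussianPDFReal 0 1
  rw [h, h, gaussPrimitive, ← intervalIntegral.integral_Iic_sub_Iic hi.integrableOn
    hi.integrableOn]
  ring

/-- The monotone transport from the standard Gaussian to a symmetric two-point mixture. -/
lemma exists_transport {a : ℝ} (ha : 0 ≤ a) :
    ∃ T : ℝ → ℝ, Measurable T ∧ (∀ x, |T x - x| ≤ a) ∧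
      (∀ x, |T x - x| ≤ a ^ 2 / 2 * |x| + a ^ 3 / 3) ∧
      (gaussianReal 0 1).map T = (2 : ℝ≥0∞)⁻¹ •
        ((gaussianReal 0 1).map (fun t => t + a) + (gaussianReal 0 1).map (fun t => t - a)) := by
  choose T hT hTa using exists_mixPrimitive_eq ha
  have hmono : Monotone T := fun x y hxy => by
    rw [← (strictMono_mixPrimitive a).le_iff_le, hT, hT]
    exact strictMono_gaussPrimitive.monotone hxy
  have hm := hmono.measurable
  refine ⟨T, hm, hTa, fun x => abs_sub_le_of_mixPrimitive_eq ha (hT x), ?_⟩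
  have : IsProbabilityMeasure ((gaussianReal 0 1).map T) :=
    Measure.isProbabilityMeasure_map hm.aemeasurable
  refine Measure.ext_of_Iic _ _ fun y => ?_
  obtain ⟨s, -, hs⟩ := intermediate_value_Icc (show y - a ≤ y + a by linarith)
    continuous_gaussPrimitive.continuousOn (show mixPrimitive a y ∈ _ from
      ⟨by
        have := strictMono_gaussPrimitive.monotone (show y - a ≤ y + a by linarith)
        unfold mixPrimitive
        linarith, by
        have := strictMono_gaussPrimitive.monotone (show y - a ≤ y + a by linarith)
        unfold mixPrimitive
        linarith⟩)
  have hpre : T ⁻¹' Set.Iic y = Set.Iic s := by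
    ext x
    simp only [Set.mem_preimage, Set.mem_Iic]
    rw [← (strictMono_mixPrimitive a).le_iff_le, hT, ← hs,
      strictMono_gaussPrimitive.le_iff_le]
  have h₁ : (fun t => t + a) ⁻¹' Set.Iic y = Set.Iic (y - a) := by
    ext x; simp [le_sub_iff_add_le]
  have h₂ : (fun t => t - a) ⁻¹' Set.Iic y = Set.Iic (y + a) := by
    ext x; simp
  rw [Measure.map_apply hm measurableSet_Iic, hpre, Measure.smul_apply, Measure.add_apply,
    Measure.map_apply (by fun_prop) measurableSet_Iic,
    Measure.map_apply (by fun_prop) measurableSet_Iic, h₁, h₂, smul_eq_mul,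
    ← ENNReal.toReal_eq_toReal_iff' (measure_ne_top _ _)
      (ENNReal.mul_ne_top (by simp) (by simp [measure_ne_top])),
    ENNReal.toReal_mul, ENNReal.toReal_add (measure_ne_top _ _) (measure_ne_top _ _)]
  simp only [← measureReal_def, gaussianReal_real_Iic s, gaussianReal_real_Iic (y - a),
    gaussianReal_real_Iic (y + a), hs, mixPrimitive, ENNReal.toReal_inv, ENNReal.toReal_ofNat]
  ring

lemma lintegral_ofReal_abs_rpow_gaussianReal {p : ℝ} (hp : 1 ≤ p) :
    (∫⁻ t, ENNReal.ofReal |t| ^ p ∂(gaussianReal 0 1)) ^ (1 / p)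
      = ENNReal.ofReal (Cconst p) := by
  have hp0 : 0 < p := by linarith
  have hi : Integrable (fun t : ℝ => |t| ^ p) (gaussianReal 0 1) := by
    have := (memLp_id_gaussianReal' (μ := 0) (v := 1) (ENNReal.ofReal p)
      ENNReal.ofReal_ne_top).integrable_norm_rpow (by simpa using hp0) ENNReal.ofReal_ne_top
    simpa [ENNReal.toReal_ofReal hp0.le] using this
  rw [Cconst, ← ENNReal.ofReal_rpow_of_nonneg (integral_nonneg fun t => by positivity)
    (by positivity), ofReal_integral_eq_lintegral_ofReal hi (ae_of_all _ fun t => by positivity)]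
  simp_rw [ENNReal.ofReal_rpow_of_nonneg (abs_nonneg _) hp0.le]

lemma one_le_Kconst (p : ℝ) : 1 ≤ Kconst p := le_max_left _ _

lemma lintegral_affine_abs_rpow_gaussianReal_le {p b c : ℝ} (hp : 1 ≤ p) (hb : 0 ≤ b)
    (hc : 0 ≤ c) :
    ∫⁻ t, ENNReal.ofReal ((b * |t| + c) ^ p) ∂(gaussianReal 0 1)
      ≤ ENNReal.ofReal ((b * Cconst p + c) ^ p) := by
  have hp0 : 0 < p := by linarith
  have hC := Cconst_nonneg p
  have hm := ENNReal.lintegral_Lp_add_le (μ := gaussianReal 0 1)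
    (f := fun t => ENNReal.ofReal b * ENNReal.ofReal |t|) (g := fun _ => ENNReal.ofReal c)
    (by fun_prop) (by fun_prop) hp
  simp only [Pi.add_apply, ENNReal.mul_rpow_of_nonneg _ _ hp0.le] at hm
  rw [lintegral_const_mul _ (by fun_prop), ENNReal.mul_rpow_of_nonneg _ _ (by positivity),
    lintegral_ofReal_abs_rpow_gaussianReal hp, lintegral_const, measure_univ, mul_one,
    ← ENNReal.rpow_mul, ← ENNReal.rpow_mul, mul_one_div_cancel hp0.ne', ENNReal.rpow_one,
    ENNReal.rpow_one, ← ENNReal.ofReal_mul hb, ← ENNReal.ofReal_add (by positivity) hc,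
    one_div, ENNReal.rpow_inv_le_iff hp0,
    ENNReal.ofReal_rpow_of_nonneg (by positivity) hp0.le] at hm
  refine le_trans (lintegral_mono fun t => le_of_eq ?_) hm
  rw [← ENNReal.ofReal_mul hb, ← ENNReal.ofReal_add (by positivity) hc,
    ENNReal.ofReal_rpow_of_nonneg (by positivity) hp0.le]

lemma lintegral_transport_le {p a : ℝ} (hp : 1 ≤ p) (ha : 0 ≤ a) {T : ℝ → ℝ}
    (h₁ : ∀ x, |T x - x| ≤ a) (h₂ : ∀ x, |T x - x| ≤ a ^ 2 / 2 * |x| + a ^ 3 / 3) :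
    ∫⁻ t, ENNReal.ofReal (|T t - t| ^ p) ∂(gaussianReal 0 1)
      ≤ ENNReal.ofReal ((Kconst p * a ^ 2) ^ p) := by
  have hp0 : 0 < p := by linarith
  have hK := one_le_Kconst p
  have hC := Cconst_nonneg p
  rcases le_total 1 a with h | h
  · calc _ ≤ ∫⁻ _, ENNReal.ofReal (a ^ p) ∂(gaussianReal 0 1) :=
          lintegral_mono fun t => ENNReal.ofReal_le_ofReal
            (rpow_le_rpow (abs_nonneg _) (h₁ t) hp0.le)
      _ = ENNReal.ofReal (a ^ p) := by simp
      _ ≤ _ := ENNReal.ofReal_le_ofReal (rpow_le_rpow ha (by nlinarith) hp0.le)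
  · calc _ ≤ ∫⁻ t, ENNReal.ofReal ((a ^ 2 / 2 * |t| + a ^ 3 / 3) ^ p) ∂(gaussianReal 0 1) :=
          lintegral_mono fun t => ENNReal.ofReal_le_ofReal
            (rpow_le_rpow (abs_nonneg _) (h₂ t) hp0.le)
      _ ≤ _ := lintegral_affine_abs_rpow_gaussianReal_le hp (by positivity) (by positivity)
      _ ≤ _ := by
          refine ENNReal.ofReal_le_ofReal (rpow_le_rpow (by positivity) ?_ hp0.le)
          have h3 : a ^ 3 ≤ a ^ 2 := pow_le_pow_of_le_one ha h (by norm_num)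
          have h4 := mul_le_mul_of_nonneg_right
            (show Cconst p / 2 + 1 / 3 ≤ Kconst p from le_max_right _ _) (sq_nonneg a)
          nlinarith

lemma stdGaussian_eq (d : ℕ) :
    _root_.stdGaussian d = ProbabilityTheory.stdGaussian (EuclideanSpace ℝ (Fin d)) :=
  map_pi_eq_stdGaussian

instance isProbabilityMeasure_stdGaussian_euclidean (d : ℕ) :
    IsProbabilityMeasure (_root_.stdGaussian d) := by
  rw [stdGaussian_eq]
  infer_instance

/-- Recombine a scalar coordinate along `e` with the part of a vector orthogonal to `e`. -/
def recombine {E : Type*} [NormedAddCommGroup E] [InnerProductSpace ℝ E] (e : E) (z : ℝ × E) :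
    E :=
  z.1 • e + (z.2 - ⟪e, z.2⟫ • e)

lemma continuous_recombine {E : Type*} [NormedAddCommGroup E] [InnerProductSpace ℝ E] (e : E) :
    Continuous (recombine e) := by
  unfold recombine
  fun_prop

lemma map_recombine_stdGaussian {d : ℕ} {e : EuclideanSpace ℝ (Fin d)}
    (he : e = 0 ∨ ‖e‖ = 1) :
    ((gaussianReal 0 1).prod (_root_.stdGaussian d)).map (recombine e)
      = _root_.stdGaussian d := by
  have hm := (continuous_recombine e).measurable
  have := Measure.isProbabilityMeasure_map (μ := (gaussianReal 0 1).prod (_root_.stdGaussian d))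
    hm.aemeasurable
  refine Measure.ext_of_charFun (funext fun w => ?_)
  have hnorm : ‖w - ⟪e, w⟫ • e‖ ^ 2 = ‖w‖ ^ 2 - ⟪e, w⟫ ^ 2 := by
    rw [norm_sub_sq_real, inner_smul_right, norm_smul, mul_pow, real_inner_comm, norm_eq_abs,
      sq_abs]
    rcases he with rfl | he
    · simp
    · rw [he]
      ring
  have hsplit : ∀ z : ℝ × EuclideanSpace ℝ (Fin d),
      Complex.exp (⟪recombine e z, w⟫ * Complex.I)
        = Complex.exp (⟪z.1, ⟪e, w⟫⟫ * Complex.I)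
          * Complex.exp (⟪z.2, w - ⟪e, w⟫ • e⟫ * Complex.I) := fun z => by
    rw [← Complex.exp_add, ← add_mul, ← Complex.ofReal_add]
    congr 3
    simp only [recombine, inner_add_left, inner_sub_left, inner_smul_left, inner_sub_right,
      inner_smul_right, real_inner_comm e z.2]
    simp
    ring
  rw [charFun_apply, integral_map hm.aemeasurable (by fun_prop)]
  simp_rw [hsplit]
  rw [integral_prod_mul (fun t : ℝ => Complex.exp (⟪t, ⟪e, w⟫⟫ * Complex.I))
      (fun z => Complex.exp (⟪z, w - ⟪e, w⟫ • e⟫ * Complex.I)),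
    ← charFun_apply, ← charFun_apply, charFun_gaussianReal, stdGaussian_eq,
    charFun_stdGaussian, charFun_stdGaussian, ← Complex.exp_add]
  congr 1
  rw [← Complex.ofReal_pow ‖w - ⟪e, w⟫ • e‖, hnorm]
  push_cast
  simp
  ring

/-- Transport of the Gaussian mixture with means `m ± u` to the Gaussian with mean `m`, moving
mass only in the direction `u`. -/
lemma exists_coupling_midpoint {d : ℕ} {p : ℝ} (hp : 1 ≤ p) (m u : EuclideanSpace ℝ (Fin d)) :
    ∃ τ : Measure (EuclideanSpace ℝ (Fin d) × EuclideanSpace ℝ (Fin d)),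
      τ.map Prod.fst = (2 : ℝ≥0∞)⁻¹ • (gaussianE d (m + u) + gaussianE d (m - u)) ∧
      τ.map Prod.snd = gaussianE d m ∧
      ∫⁻ z, ENNReal.ofReal (‖z.1 - z.2‖ ^ p) ∂τ
        ≤ ENNReal.ofReal ((Kconst p * ‖u‖ ^ 2) ^ p) := by
  have hp0 : 0 < p := by linarith
  obtain ⟨T, hT, h₁, h₂, hmap⟩ := exists_transport (norm_nonneg u)
  set e := ‖u‖⁻¹ • u with he
  have heu : ‖u‖ • e = u := by
    rcases eq_or_ne u 0 with rfl | hu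
    · simp
    · rw [he, smul_smul, mul_inv_cancel₀ (norm_ne_zero_iff.2 hu), one_smul]
  have he01 : e = 0 ∨ ‖e‖ = 1 := by
    rcases eq_or_ne u 0 with rfl | hu
    · left; simp [he]
    · right; rw [he, norm_smul, norm_inv, norm_norm, inv_mul_cancel₀ (norm_ne_zero_iff.2 hu)]
  have he1 : ‖e‖ ≤ 1 := by
    rcases he01 with h | h
    · simp [h]
    · exact h.le
  set γ := gaussianReal 0 1
  set G := _root_.stdGaussian d
  have hR := (continuous_recombine e).measurable
  have hRG : (γ.prod G).map (recombine e) = G := map_recombine_stdGaussian he01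
  have hfst : Measurable (fun z : ℝ × EuclideanSpace ℝ (Fin d) => m + recombine e (T z.1, z.2)) :=
    (hR.comp ((hT.comp measurable_fst).prodMk measurable_snd)).const_add m
  have hsnd : Measurable (fun z : ℝ × EuclideanSpace ℝ (Fin d) => m + recombine e z) :=
    hR.const_add m
  have hG : ∀ c, gaussianE d c = (γ.prod G).map (fun z => c + recombine e z) := fun c => by
    rw [gaussianE, show _root_.stdGaussian d = (γ.prod G).map (recombine e) from hRG.symm,
      Measure.map_map (by fun_prop) hR]
    rfl
  have hshift : ∀ b : ℝ, ((γ.map (fun t => t + b)).prod G).map (fun z => m + recombine e z)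
      = gaussianE d (m + b • e) := fun b => by
    have hb : Measurable (fun t : ℝ => t + b) := by fun_prop
    have hprod : (γ.map (fun t => t + b)).prod G
        = (γ.prod G).map (Prod.map (fun t => t + b) id) := by
      rw [← Measure.map_prod_map _ _ hb measurable_id, Measure.map_id]
    rw [hG, hprod, Measure.map_map hsnd (hb.prodMap measurable_id)]
    congr 1
    ext1 z
    simp only [Function.comp, recombine, Prod.map, id, add_smul]
    abel
  refine ⟨(γ.prod G).map fun z => (m + recombine e (T z.1, z.2), m + recombine e z), ?_, ?_, ?_⟩
  · rw [Measure.map_map measurable_fst (hfst.prodMk hsnd)]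
    have hprod : (γ.map T).prod G = (γ.prod G).map (Prod.map T id) := by
      rw [← Measure.map_prod_map _ _ hT measurable_id, Measure.map_id]
    have : (γ.prod G).map (Prod.fst ∘ fun z => (m + recombine e (T z.1, z.2), m + recombine e z))
        = ((γ.map T).prod G).map (fun z => m + recombine e z) := by
      rw [hprod, Measure.map_map hsnd (hT.prodMap measurable_id)]
      rfl
    have hneg := hshift (-‖u‖)
    simp only [← sub_eq_add_neg, neg_smul] at hneg
    rw [this, hmap, Measure.prod_smul_left, Measure.map_smul, Measure.add_prod,
      Measure.map_add _ _ hsnd, hshift, hneg, heu]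
  · rw [Measure.map_map measurable_snd (hfst.prodMk hsnd), hG]
    rfl
  · rw [lintegral_map (by fun_prop) (hfst.prodMk hsnd)]
    calc _ ≤ ∫⁻ z : ℝ × EuclideanSpace ℝ (Fin d),
            ENNReal.ofReal (|T z.1 - z.1| ^ p) ∂(γ.prod G) := by
          refine lintegral_mono fun z => ENNReal.ofReal_le_ofReal
            (rpow_le_rpow (norm_nonneg _) ?_ hp0.le)
          have : m + recombine e (T z.1, z.2) - (m + recombine e z) = (T z.1 - z.1) • e := by
            simp only [recombine, sub_smul]
            abel
          simp only [this, norm_smul, norm_eq_abs]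
          exact mul_le_of_le_one_right (abs_nonneg _) he1
      _ = ∫⁻ t, ENNReal.ofReal (|T t - t| ^ p) ∂γ := by
          rw [lintegral_prod _ (by fun_prop)]
          simp
      _ ≤ _ := lintegral_transport_le hp (norm_nonneg u) h₁ h₂

lemma Wp_smul_sum_le {ι E : Type*} [Fintype ι] [MeasurableSpace E] [NormedAddCommGroup E]
    {p : ℝ} (hp : 0 < p) (c : ℝ≥0∞) {μ ν : ι → Measure E} {τ : ι → Measure (E × E)}
    {B : ℝ≥0∞} (h₁ : ∀ i, (τ i).map Prod.fst = μ i) (h₂ : ∀ i, (τ i).map Prod.snd = ν i)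
    (hB : c * ∑ i, ∫⁻ z, ENNReal.ofReal (‖z.1 - z.2‖ ^ p) ∂(τ i) ≤ B ^ p) :
    Wp p (c • ∑ i, μ i) (c • ∑ i, ν i) ≤ B := by
  have hmem : c • ∑ i, τ i ∈ couplings (c • ∑ i, μ i) (c • ∑ i, ν i) := by
    constructor
    · rw [Measure.map_smul, Measure.map_finset_sum measurable_fst.aemeasurable]
      simp only [h₁]
    · rw [Measure.map_smul, Measure.map_finset_sum measurable_snd.aemeasurable]
      simp only [h₂]
  rw [Wp, one_div, ENNReal.rpow_inv_le_iff hp]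
  refine (iInf₂_le _ hmem).trans (le_of_eq_of_le ?_ hB)
  rw [lintegral_smul_measure, lintegral_finsetSum_measure, smul_eq_mul]

lemma norm_sub_rpow_le {E : Type*} [NormedAddCommGroup E] (v w : E) {q : ℝ} (hq : 1 ≤ q) :
    ‖v - w‖ ^ q ≤ 2 ^ (q - 1) * (‖v‖ ^ q + ‖w‖ ^ q) :=
  (rpow_le_rpow (norm_nonneg _) (norm_sub_le v w) (by linarith)).trans
    (mod_cast NNReal.rpow_add_le_mul_rpow_add_rpow ‖v‖₊ ‖w‖₊ hq)

lemma sum_norm_sub_involutive_rpow_le {ι E : Type*} [Fintype ι] [NormedAddCommGroup E]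
    (x : ι → E) {M : ι → ι} (hM : Function.Involutive M) {q : ℝ} (hq : 1 ≤ q) :
    ∑ i, ‖x i - x (M i)‖ ^ q ≤ 2 ^ q * ∑ i, ‖x i‖ ^ q := by
  have hsum : ∑ i, ‖x (M i)‖ ^ q = ∑ i, ‖x i‖ ^ q :=
    Equiv.sum_comp hM.toPerm fun i => ‖x i‖ ^ q
  calc _ ≤ ∑ i, 2 ^ (q - 1) * (‖x i‖ ^ q + ‖x (M i)‖ ^ q) :=
        Finset.sum_le_sum fun i _ => norm_sub_rpow_le _ _ hq
    _ = 2 ^ q * ∑ i, ‖x i‖ ^ q := by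
        rw [← Finset.mul_sum, Finset.sum_add_distrib, hsum, rpow_sub_one two_ne_zero]
        ring

/-- one-step Wasserstein bound for midpoint replacement of Gaussian mixtures. -/
theorem wasserstein_midpoint_mixture
    (n : ℕ) (hn : 0 < n) (d : ℕ) (p : ℝ) (hp : 1 ≤ p)
    (x : Fin (2 * n) → EuclideanSpace ℝ (Fin d))
    (M : Fin (2 * n) → Fin (2 * n))
    (hM : Function.Involutive M) (hMfix : ∀ i, M i ≠ i)
    (y : Fin (2 * n) → EuclideanSpace ℝ (Fin d))
    (hy : ∀ i, y i = (2 : ℝ)⁻¹ • (x i + x (M i))) :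
    Wp p (((2 * n : ℝ≥0∞))⁻¹ • ∑ i, gaussianE d (x i))
        (((2 * n : ℝ≥0∞))⁻¹ • ∑ i, gaussianE d (y i)) ≤
      ENNReal.ofReal
        (Kconst p / 4 * ((1 / (2 * n)) * ∑ i, ‖x i - x (M i)‖ ^ (2 * p)) ^ (1 / p)) ∧
    Kconst p / 4 * ((1 / (2 * n)) * ∑ i, ‖x i - x (M i)‖ ^ (2 * p)) ^ (1 / p) ≤
      Kconst p * ((1 / (2 * n)) * ∑ i, ‖x i‖ ^ (2 * p)) ^ (1 / p) := by
  have hp0 : 0 < p := by linarith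
  have hK : 0 ≤ Kconst p := zero_le_one.trans (one_le_Kconst p)
  have hn0 : (0 : ℝ) < n := Nat.cast_pos.2 hn
  constructor
  · choose τ hfst hsnd hcost using fun i =>
      exists_coupling_midpoint hp (y i) ((2 : ℝ)⁻¹ • (x i - x (M i)))
    have hadd : ∀ i, y i + (2 : ℝ)⁻¹ • (x i - x (M i)) = x i := fun i => by
      rw [hy]
      module
    have hsub : ∀ i, y i - (2 : ℝ)⁻¹ • (x i - x (M i)) = x (M i) := fun i => by
      rw [hy]
      module
    have hsum : ∑ i, gaussianE d (x i)
        = ∑ i, (2 : ℝ≥0∞)⁻¹ • (gaussianE d (x i) + gaussianE d (x (M i))) := by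
      have : ∑ i, gaussianE d (x (M i)) = ∑ i, gaussianE d (x i) :=
        Equiv.sum_comp hM.toPerm fun i => gaussianE d (x i)
      rw [← Finset.smul_sum, Finset.sum_add_distrib, this, smul_add, ← add_smul,
        ENNReal.inv_two_add_inv_two, one_smul]
    simp only [hadd, hsub] at hfst
    rw [hsum]
    refine Wp_smul_sum_le hp0 _ hfst hsnd ?_
    have hcost' : ∀ i, ∫⁻ z, ENNReal.ofReal (‖z.1 - z.2‖ ^ p) ∂(τ i)
        ≤ ENNReal.ofReal ((Kconst p / 4) ^ p * ‖x i - x (M i)‖ ^ (2 * p)) := fun i => by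
      refine (hcost i).trans_eq ?_
      rw [norm_smul, Real.rpow_mul (norm_nonneg _), ← mul_rpow (by positivity) (by positivity),
        Real.rpow_two]
      norm_num
      ring_nf
    have hc : ((2 * n : ℝ≥0∞))⁻¹ = ENNReal.ofReal (1 / (2 * n)) := by
      rw [one_div, ENNReal.ofReal_inv_of_pos (by positivity), ENNReal.ofReal_mul two_pos.le]
      simp
    refine (mul_le_mul_right (Finset.sum_le_sum fun i _ => hcost' i) _).trans_eq ?_
    rw [← ENNReal.ofReal_sum_of_nonneg fun i _ => by positivity, hc,
      ← ENNReal.ofReal_mul (by positivity),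
      ENNReal.ofReal_rpow_of_nonneg (by positivity) hp0.le,
      mul_rpow (by positivity) (by positivity), ← Real.rpow_mul (by positivity),
      one_div_mul_cancel hp0.ne', Real.rpow_one, ← Finset.mul_sum]
    congr 1
    ring
  · have hle : (1 / (2 * n)) * ∑ i, ‖x i - x (M i)‖ ^ (2 * p)
        ≤ 4 ^ p * ((1 / (2 * n)) * ∑ i, ‖x i‖ ^ (2 * p)) := by
      have h := sum_norm_sub_involutive_rpow_le x hM (show 1 ≤ 2 * p by linarith)
      rw [rpow_mul two_pos.le, Real.rpow_two, show (2 : ℝ) ^ 2 = 4 by norm_num] at h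
      rw [mul_left_comm]
      exact mul_le_mul_of_nonneg_left h (by positivity)
    have h := rpow_le_rpow (by positivity) hle (show 0 ≤ 1 / p by positivity)
    rw [mul_rpow (x := 4 ^ p) (by positivity) (by positivity), ← Real.rpow_mul (by norm_num),
      mul_one_div_cancel hp0.ne', Real.rpow_one] at h
    calc _ ≤ Kconst p / 4 * (4 * ((1 / (2 * n)) * ∑ i, ‖x i‖ ^ (2 * p)) ^ (1 / p)) :=
          mul_le_mul_of_nonneg_left h (by positivity)
      _ = _ := by ring

end
end
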